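/- Fix integers n, m, K, L, q ≥ 1. For each t = 1,…,m let X_t be an n×K real matrix, Y_t an n×L real matrix, and Z_t an n×q real matrix with Z_tᵀ Z_t invertible. Define the stacked matrices Ẋ (of size (mn)×K) and Ẏ (of size (mn)×L) whose (t,i)-th rows are the i-th rows of X_t and Y_t respectively, and define the block-diagonal instrument matrix Z̃ of size (mn)×(mq) by Z̃((t,i),(t',a)) = Z_t(i,a) if t = t' and 0 otherwise. Then Z̃ᵀ Z̃ is invertible and Ẋᵀ Z̃ (Z̃ᵀ Z̃)⁻¹ Z̃ᵀ Ẏ = Σ_{t=1}^{m} X_tᵀ Z_t (Z_tᵀ Z_t)⁻¹ Z_tᵀ Y_t. -/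

import Mathlib

open Matrix

namespace Matrix

variable {m n o p k l R : Type*} [CommRing R] [Fintype o] [DecidableEq o]

theorem inv_blockDiagonal_of_isUnit_det [Fintype n] [DecidableEq n] {M : o → Matrix n n R}
    (hM : ∀ t, IsUnit (M t).det) : (blockDiagonal M)⁻¹ = blockDiagonal fun t => (M t)⁻¹ := by
  refine inv_eq_right_inv ?_
  rw [← blockDiagonal_mul, ← blockDiagonal_one]
  congr 1
  ext1 t
  exact mul_nonsing_inv _ (hM t)

/-- A bilinear form in stacked matrices with a block-diagonal kernel is the sum of the
forms of the blocks. -/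
theorem transpose_mul_blockDiagonal_mul_of_stacked [Fintype m] [Fintype n]
    (X : o → Matrix m k R) (P : o → Matrix m n R) (Y : o → Matrix n l R) :
    (of fun (i : m × o) a => X i.2 i.1 a)ᵀ * blockDiagonal P *
        (of fun (j : n × o) b => Y j.2 j.1 b) =
      ∑ t, (X t)ᵀ * P t * Y t := by
  ext a b
  simp only [mul_apply, sum_apply, transpose_apply, of_apply, blockDiagonal_apply,
    Fintype.sum_prod_type, mul_ite, mul_zero, Finset.sum_ite_eq', Finset.mem_univ, if_true]
  exact Finset.sum_comm

end Matrix

/-- Equivalence of the period-by-period form and the stacked block-diagonal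
two-stage least squares form: with `Ẋ`, `Ẏ` the stacked regressor and outcome
matrices and `Z̃` the block-diagonal instrument matrix with blocks `Z_t`,
`Z̃ᵀ Z̃` is invertible and
`Ẋᵀ Z̃ (Z̃ᵀ Z̃)⁻¹ Z̃ᵀ Ẏ = ∑_t X_tᵀ Z_t (Z_tᵀ Z_t)⁻¹ Z_tᵀ Y_t`. -/
theorem blockdiag_tsls_eq_sum_projections
    (n m K L q : ℕ) (hn : 1 ≤ n) (hm : 1 ≤ m) (hK : 1 ≤ K) (hL : 1 ≤ L)
    (hq : 1 ≤ q)
    (X : Fin m → Matrix (Fin n) (Fin K) ℝ)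
    (Y : Fin m → Matrix (Fin n) (Fin L) ℝ)
    (Z : Fin m → Matrix (Fin n) (Fin q) ℝ)
    (hZ : ∀ t, IsUnit ((Z t)ᵀ * Z t).det)
    (Xdot : Matrix (Fin m × Fin n) (Fin K) ℝ)
    (hX : ∀ (p : Fin m × Fin n) (k : Fin K), Xdot p k = X p.1 p.2 k)
    (Ydot : Matrix (Fin m × Fin n) (Fin L) ℝ)
    (hY : ∀ (p : Fin m × Fin n) (l : Fin L), Ydot p l = Y p.1 p.2 l)
    (Ztilde : Matrix (Fin m × Fin n) (Fin m × Fin q) ℝ)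
    (hZt : ∀ (p : Fin m × Fin n) (c : Fin m × Fin q),
      Ztilde p c = if p.1 = c.1 then Z p.1 p.2 c.2 else 0) :
    IsUnit (Ztildeᵀ * Ztilde).det ∧
      Xdotᵀ * Ztilde * (Ztildeᵀ * Ztilde)⁻¹ * Ztildeᵀ * Ydot =
        ∑ t : Fin m, (X t)ᵀ * Z t * ((Z t)ᵀ * Z t)⁻¹ * (Z t)ᵀ * Y t := by
  let σ (r : ℕ) : Fin m × Fin r ≃ Fin r × Fin m := Equiv.prodComm _ _
  have eX : Xdot = (of fun (i : Fin n × Fin m) a => X i.2 i.1 a).submatrix (σ n) id := by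
    ext p a
    exact hX p a
  have eY : Ydot = (of fun (i : Fin n × Fin m) a => Y i.2 i.1 a).submatrix (σ n) id := by
    ext p a
    exact hY p a
  have eZ : Ztilde = (blockDiagonal Z).submatrix (σ n) (σ q) := by
    ext p c
    simp [hZt, σ, blockDiagonal_apply]
  have gram : Ztildeᵀ * Ztilde =
      (blockDiagonal fun t => (Z t)ᵀ * Z t).submatrix (σ q) (σ q) := by
    rw [eZ, transpose_submatrix, submatrix_mul_equiv, blockDiagonal_transpose,
      ← blockDiagonal_mul]
  constructor
  · rw [gram, det_submatrix_equiv_self, det_blockDiagonal]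
    exact (IsUnit.prod_univ_iff).2 hZ
  · rw [gram, inv_submatrix_equiv, inv_blockDiagonal_of_isUnit_det hZ, eX, eY, eZ]
    simp only [transpose_submatrix, submatrix_mul_equiv, blockDiagonal_transpose,
      submatrix_id_id]
    have key := transpose_mul_blockDiagonal_mul_of_stacked X
      (fun t => Z t * ((Z t)ᵀ * Z t)⁻¹ * (Z t)ᵀ) Y
    simpa only [blockDiagonal_mul, ← Matrix.mul_assoc] using key
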